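/- arXiv:2208.01010 — 3 statements merged into one kernel-verified Lean document; each statement's English description precedes it below -/
import Mathlib

section
/- For all integers q ≥ 1 and s, t ≥ 2 (with s = t when q = 1), every row-increasing q × N real matrix with N ≥ 2^{(q+1)s t^{q−1}} contains a cupcap submatrix that is either q × s with every row a cap, or q × t with at least one row a cup. -/
/-- A sequence is a cup if `x i + x l ≥ 2 * x j` for all `i < j < l`. -/
def IsCup {n : ℕ} (x : Fin n → ℝ) : Prop :=
  ∀ i j l : Fin n, i < j → j < l → x i + x l ≥ 2 * x j

/-- A sequence is a cap if `x i + x l ≤ 2 * x j` for all `i < j < l`. -/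
def IsCap {n : ℕ} (x : Fin n → ℝ) : Prop :=
  ∀ i j l : Fin n, i < j → j < l → x i + x l ≤ 2 * x j

/-- `M` contains a cupcap submatrix that is either `q × s` with every row a cap, or
`q × t` with at least one row a cup. -/
def HasCupcapSub (q s t N : ℕ) (M : Fin q → Fin N → ℝ) : Prop :=
  (∃ g : Fin s → Fin N, StrictMono g ∧
      (∀ i, StrictMono (fun j => M i (g j)) ∨ StrictAnti (fun j => M i (g j))) ∧
      ∀ i, IsCap (fun j => M i (g j))) ∨
  (∃ g : Fin t → Fin N, StrictMono g ∧
      (∀ i, StrictMono (fun j => M i (g j)) ∨ StrictAnti (fun j => M i (g j))) ∧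
      (∀ i, IsCup (fun j => M i (g j)) ∨ IsCap (fun j => M i (g j))) ∧
      ∃ i, IsCup (fun j => M i (g j)))

/-- `x` is a cup along the columns in `T`. -/
def CupOn {ι : Type*} [LinearOrder ι] (x : ι → ℝ) (T : Finset ι) : Prop :=
  ∀ i ∈ T, ∀ j ∈ T, ∀ l ∈ T, i < j → j < l → 2 * x j ≤ x i + x l

/-- `x` is a cap along the columns in `T`. -/
def CapOn {ι : Type*} [LinearOrder ι] (x : ι → ℝ) (T : Finset ι) : Prop :=
  ∀ i ∈ T, ∀ j ∈ T, ∀ l ∈ T, i < j → j < l → x i + x l ≤ 2 * x j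

theorem CupOn.mono {ι : Type*} [LinearOrder ι] {x : ι → ℝ} {S T : Finset ι} (h : CupOn x S)
    (hTS : T ⊆ S) : CupOn x T :=
  fun i hi j hj l hl => h i (hTS hi) j (hTS hj) l (hTS hl)

theorem CupOn.isCup {ι : Type*} [LinearOrder ι] {x : ι → ℝ} {T : Finset ι} {n : ℕ}
    (h : CupOn x T) (hT : T.card = n) : IsCup fun j => x (T.orderEmbOfFin hT j) :=
  fun _ _ _ hij hjl => h _ (T.orderEmbOfFin_mem hT _) _ (T.orderEmbOfFin_mem hT _) _
    (T.orderEmbOfFin_mem hT _) ((T.orderEmbOfFin hT).strictMono hij)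
    ((T.orderEmbOfFin hT).strictMono hjl)

theorem CapOn.isCap {ι : Type*} [LinearOrder ι] {x : ι → ℝ} {T : Finset ι} {n : ℕ}
    (h : CapOn x T) (hT : T.card = n) : IsCap fun j => x (T.orderEmbOfFin hT j) :=
  fun _ _ _ hij hjl => h _ (T.orderEmbOfFin_mem hT _) _ (T.orderEmbOfFin_mem hT _) _
    (T.orderEmbOfFin_mem hT _) ((T.orderEmbOfFin hT).strictMono hij)
    ((T.orderEmbOfFin hT).strictMono hjl)

theorem CapOn.insert_left {ι : Type*} [LinearOrder ι] {x : ι → ℝ} {T : Finset ι} {a : ι}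
    (h : CapOn x T) (ha : ∀ j ∈ T, a < j)
    (hx : ∀ j ∈ T, ∀ l ∈ T, j < l → x a + x l ≤ 2 * x j) : CapOn x (insert a T) := by
  have hmem : ∀ i ∈ insert a T, ∀ j ∈ insert a T, i < j → j ∈ T := by
    intro i hi j hj hij
    refine (Finset.mem_insert.1 hj).resolve_left ?_
    rintro rfl
    rcases Finset.mem_insert.1 hi with h' | h'
    · exact hij.ne h'
    · exact hij.not_gt (ha i h')
  intro i hi j hj l hl hij hjl
  have hjT := hmem i hi j hj hij
  have hlT := hmem j hj l hl hjl
  rcases Finset.mem_insert.1 hi with h' | h'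
  · exact h' ▸ hx j hjT l hlT hjl
  · exact h i h' j hjT l hlT hij hjl

theorem CupOn.insert_right {ι : Type*} [LinearOrder ι] {x : ι → ℝ} {T : Finset ι} {b : ι}
    (h : CupOn x T) (hb : ∀ j ∈ T, j < b)
    (hx : ∀ i ∈ T, ∀ j ∈ T, i < j → 2 * x j ≤ x i + x b) : CupOn x (insert b T) := by
  have hmem : ∀ i ∈ insert b T, ∀ j ∈ insert b T, i < j → i ∈ T := by
    intro i hi j hj hij
    refine (Finset.mem_insert.1 hi).resolve_left ?_
    rintro rfl
    rcases Finset.mem_insert.1 hj with h' | h'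
    · exact hij.ne' h'
    · exact hij.not_gt (hb j h')
  intro i hi j hj l hl hij hjl
  have hiT := hmem i hi j hj hij
  have hjT := hmem j hj l hl hjl
  rcases Finset.mem_insert.1 hl with h' | h'
  · exact h' ▸ hx i hiT j hjT hij
  · exact h i hiT j hjT l h' hij hjl

/-- A single increasing row of length `2 ^ (a + b)` contains a cap of length `a` or a cup of
length `b`. -/
theorem exists_capOn_or_cupOn {ι : Type*} [LinearOrder ι] {x : ι → ℝ} (hx : StrictMono x)
    (a b : ℕ) (S : Finset ι) (hS : 2 ^ (a + b) ≤ S.card) :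
    ∃ T ⊆ S, (T.card = a ∧ CapOn x T) ∨ (T.card = b ∧ CupOn x T) := by
  induction hn : a + b generalizing a b S with
  | zero =>
    obtain ⟨rfl, rfl⟩ : a = 0 ∧ b = 0 := by omega
    exact ⟨∅, by simp, Or.inl ⟨rfl, by simp [CapOn]⟩⟩
  | succ n ih =>
    rcases a with _ | a
    · exact ⟨∅, by simp, Or.inl ⟨rfl, by simp [CapOn]⟩⟩
    rcases b with _ | b
    · exact ⟨∅, by simp, Or.inr ⟨rfl, by simp [CupOn]⟩⟩
    rw [hn] at hS
    have hn1 : 2 ≤ 2 ^ n := by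
      calc 2 = 2 ^ 1 := rfl
        _ ≤ 2 ^ n := Nat.pow_le_pow_right (by norm_num) (by omega)
    have hcard : 1 < S.card := by rw [pow_succ] at hS; omega
    have hne : S.Nonempty := Finset.card_pos.1 (by omega)
    have hlt : S.min' hne < S.max' hne := Finset.min'_lt_max'_of_card S hcard
    have hxlt := hx hlt
    have hsplit := Finset.card_filter_add_card_filter_not (s := S)
      (fun j => 2 * x j ≤ x (S.min' hne) + x (S.max' hne))
    set L := S.filter (fun j => 2 * x j ≤ x (S.min' hne) + x (S.max' hne)) with hL
    set U := S.filter (fun j => ¬ 2 * x j ≤ x (S.min' hne) + x (S.max' hne)) with hU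
    have hLU : 2 ^ n ≤ L.card ∨ 2 ^ n ≤ U.card := by rw [pow_succ] at hS; omega
    rcases hLU with h | h
    · obtain ⟨T, hT, ⟨hc, hcap⟩ | ⟨hc, hcup⟩⟩ :=
        ih (a + 1) b L (by rwa [show a + 1 + b = n by omega]) (by omega)
      · exact ⟨T, hT.trans (Finset.filter_subset _ _), Or.inl ⟨hc, hcap⟩⟩
      · have hTmem : ∀ j ∈ T, j ∈ S ∧ 2 * x j ≤ x (S.min' hne) + x (S.max' hne) :=
          fun j hj => Finset.mem_filter.1 (hT hj)
        have hTlt : ∀ j ∈ T, j < S.max' hne := by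
          intro j hj
          refine lt_of_le_of_ne (S.le_max' j (hTmem j hj).1) ?_
          rintro rfl
          linarith [(hTmem _ hj).2]
        refine ⟨insert (S.max' hne) T, ?_, Or.inr ⟨?_, ?_⟩⟩
        · exact Finset.insert_subset (S.max'_mem hne) fun j hj => (hTmem j hj).1
        · rw [Finset.card_insert_of_notMem fun hm => (hTlt _ hm).false, hc]
        · refine hcup.insert_right hTlt fun i hi j hj _ => ?_
          have := hx.monotone (S.min'_le i (hTmem i hi).1)
          linarith [(hTmem j hj).2]
    · obtain ⟨T, hT, ⟨hc, hcap⟩ | ⟨hc, hcup⟩⟩ :=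
        ih a (b + 1) U (by rwa [show a + (b + 1) = n by omega]) (by omega)
      · have hTmem : ∀ j ∈ T, j ∈ S ∧ ¬ 2 * x j ≤ x (S.min' hne) + x (S.max' hne) :=
          fun j hj => Finset.mem_filter.1 (hT hj)
        have hTlt : ∀ j ∈ T, S.min' hne < j := by
          intro j hj
          refine lt_of_le_of_ne (S.min'_le j (hTmem j hj).1) ?_
          rintro rfl
          exact (hTmem _ hj).2 (by linarith)
        refine ⟨insert (S.min' hne) T, ?_, Or.inl ⟨?_, ?_⟩⟩
        · exact Finset.insert_subset (S.min'_mem hne) fun j hj => (hTmem j hj).1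
        · rw [Finset.card_insert_of_notMem fun hm => (hTlt _ hm).false, hc]
        · refine hcap.insert_left hTlt fun j hj l hl _ => ?_
          have := hx.monotone (S.le_max' l (hTmem l hl).1)
          linarith [not_le.1 (hTmem j hj).2]
      · exact ⟨T, hT.trans (Finset.filter_subset _ _), Or.inr ⟨hc, hcup⟩⟩

/-- Among the columns of `S`, all to the right of `a`, either some row has a cup of length `m`, or
there is a large set of columns in which each pair `j < l` forms a cap with `a` in every row. -/
theorem exists_cupOn_or_fiber {ι ρ : Type*} [LinearOrder ι] {M : ρ → ι → ℝ}
    (hM : ∀ i, StrictMono (M i)) (R : Finset ρ) (a : ι) (S : Finset ι) (ha : ∀ j ∈ S, a < j)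
    (m n : ℕ) (hS : R.card * m * n < S.card) (hR : 1 ≤ R.card) :
    (∃ i ∈ R, ∃ T ⊆ S, T.card = m ∧ CupOn (M i) T) ∨
      ∃ T ⊆ S, n ≤ T.card ∧
        ∀ i ∈ R, ∀ j ∈ T, ∀ l ∈ T, j < l → M i a + M i l ≤ 2 * M i j := by
  classical
  by_contra! hcon
  obtain ⟨hcup, hfib⟩ := hcon
  let P : ρ → ι → ℕ → Prop := fun i j k =>
    ∃ T ⊆ S, T.card = k ∧ (∀ l ∈ T, l ≤ j) ∧
      ∀ u ∈ T, ∀ v ∈ T, u < v → 2 * (M i u - M i a) ≤ M i v - M i a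
  let c : ρ → ι → ℕ := fun i j => Nat.findGreatest (P i j) m
  have hP0 : ∀ i j, P i j 0 := fun i j => ⟨∅, by simp, rfl, by simp, by simp⟩
  have hPc : ∀ i j, P i j (c i j) := fun i j => Nat.findGreatest_spec (Nat.zero_le m) (hP0 i j)
  have hclt : ∀ i ∈ R, ∀ j, c i j < m := by
    intro i hi j
    refine lt_of_le_of_ne (Nat.findGreatest_le m) fun he => ?_
    obtain ⟨T, hTS, hTc, -, hT⟩ := hPc i j
    refine hcup i hi T hTS (hTc.trans he) fun u hu v hv w hw huv hvw => ?_
    have h1 := hT v hv w hw hvw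
    have h2 := hM i (ha u (hTS hu))
    linarith
  have hcmono : ∀ i, ∀ j l, j ≤ l → c i j ≤ c i l := by
    intro i j l hjl
    refine Nat.le_findGreatest (Nat.findGreatest_le m) ?_
    obtain ⟨T, hTS, hTc, hTj, hT⟩ := hPc i j
    exact ⟨T, hTS, hTc, fun u hu => (hTj u hu).trans hjl, hT⟩
  have hcstep : ∀ i ∈ R, ∀ j, ∀ l ∈ S, j < l → 2 * (M i j - M i a) ≤ M i l - M i a →
      c i j < c i l := by
    intro i hi j l hl hjl hd
    refine Nat.le_findGreatest (hclt i hi j) ?_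
    obtain ⟨T, hTS, hTc, hTj, hT⟩ := hPc i j
    have hlT : ∀ u ∈ T, u < l := fun u hu => (hTj u hu).trans_lt hjl
    refine ⟨insert l T, Finset.insert_subset hl hTS, ?_, ?_, ?_⟩
    · rw [Finset.card_insert_of_notMem fun hm => (hlT _ hm).false, hTc]
    · intro u hu
      rcases Finset.mem_insert.1 hu with rfl | hu
      · exact le_rfl
      · exact (hlT u hu).le
    · intro u hu v hv huv
      have huT : u ∈ T := by
        refine (Finset.mem_insert.1 hu).resolve_left ?_
        rintro rfl
        rcases Finset.mem_insert.1 hv with h' | h'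
        · exact huv.ne' h'
        · exact huv.not_gt (hlT v h')
      rcases Finset.mem_insert.1 hv with rfl | h'
      · have := (hM i).monotone (hTj u huT)
        linarith
      · exact hT u huT v h' huv
  have hmaps : ∀ j ∈ S, ∑ i ∈ R, c i j ∈ Finset.range (R.card * m) := by
    intro j _
    rw [Finset.mem_range, ← smul_eq_mul, ← Finset.sum_const]
    exact Finset.sum_lt_sum_of_nonempty (Finset.card_pos.1 hR) fun i hi => hclt i hi j
  obtain ⟨y, -, hy⟩ := Finset.exists_lt_card_fiber_of_mul_lt_card_of_maps_to hmaps
    (by rwa [Finset.card_range])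
  obtain ⟨i, hi, j, hj, l, hl, hjl, hlt⟩ := hfib _ (Finset.filter_subset _ _) hy.le
  rw [Finset.mem_filter] at hj hl
  have h1 := hcstep i hi j l hl.1 hjl (by linarith)
  have h2 : ∑ i ∈ R, c i j < ∑ i ∈ R, c i l :=
    Finset.sum_lt_sum (fun k _ => hcmono k j l hjl.le) ⟨i, hi, h1⟩
  omega

/-- `T` consists of columns that are either caps of length `s` in all rows of `R`, or of length `t`
with every row of `R` a cup or a cap and some row of `R` a cup. -/
def CupcapOn {ι ρ : Type*} [LinearOrder ι] (M : ρ → ι → ℝ) (R : Finset ρ) (s t : ℕ)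
    (T : Finset ι) : Prop :=
  (T.card = s ∧ ∀ i ∈ R, CapOn (M i) T) ∨
    (T.card = t ∧ (∀ i ∈ R, CupOn (M i) T ∨ CapOn (M i) T) ∧ ∃ i ∈ R, CupOn (M i) T)

/-- The finset form of `fq_bound`, for `q + 1` rows. -/
theorem exists_cupcapOn {ι ρ : Type*} [LinearOrder ι] {M : ρ → ι → ℝ}
    (hM : ∀ i, StrictMono (M i)) {t : ℕ} (ht : 2 ≤ t) (q : ℕ) (R : Finset ρ)
    (hR : R.card = q + 1) (s : ℕ) (hst : q = 0 → s = t) (S : Finset ι)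
    (hS : 2 ^ ((q + 2) * s * t ^ q) ≤ S.card) : ∃ T ⊆ S, CupcapOn M R s t T := by
  classical
  induction q generalizing R s S with
  | zero =>
    obtain rfl := hst rfl
    obtain ⟨i, rfl⟩ := Finset.card_eq_one.1 hR
    obtain ⟨T, hT, ⟨hc, h⟩ | ⟨hc, h⟩⟩ := exists_capOn_or_cupOn (hM i) s s S
      (by convert hS using 2; ring)
    · exact ⟨T, hT, Or.inl ⟨hc, by simpa using h⟩⟩
    · exact ⟨T, hT, Or.inr ⟨hc, by simpa using Or.inl h, by simpa using h⟩⟩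
  | succ q ih =>
    clear hst
    induction s generalizing S with
    | zero => exact ⟨∅, by simp, Or.inl ⟨rfl, by simp [CapOn]⟩⟩
    | succ s ihs =>
      set n := 2 ^ ((q + 1 + 2) * s * t ^ (q + 1)) with hn
      set m := 2 ^ ((q + 2) * t * t ^ q) with hm
      have hm2 : 2 ≤ m := by
        calc 2 = 2 ^ 1 := rfl
          _ ≤ m := Nat.pow_le_pow_right (by norm_num) (Nat.pos_of_ne_zero (by positivity))
      have hn1 : 1 ≤ n := Nat.one_le_two_pow
      have hq : q + 3 ≤ 2 ^ t ^ (q + 1) := by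
        have h1 : q + 1 + 1 ≤ 2 ^ (q + 1) := Nat.lt_two_pow_self
        have h2 : q + 2 + 1 ≤ 2 ^ (q + 2) := Nat.lt_two_pow_self
        exact h2.trans (Nat.pow_le_pow_right (by norm_num)
          (h1.trans (Nat.pow_le_pow_left ht _)))
      have hSn : (q + 3) * m * n ≤ S.card := by
        refine le_trans ?_ hS
        calc (q + 3) * m * n ≤ 2 ^ t ^ (q + 1) * m * n := by gcongr
          _ = 2 ^ ((q + 1 + 2) * (s + 1) * t ^ (q + 1)) := by
            rw [hm, hn, ← pow_add, ← pow_add]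
            ring_nf
      have hmn : 2 ≤ m * n := by nlinarith
      have hexp : (q + 3) * m * n = (q + 2) * m * n + m * n := by ring
      have hne : S.Nonempty := Finset.card_pos.1 (by omega)
      have haS := S.min'_mem hne
      set a := S.min' hne with ha
      have hlt : ∀ j ∈ S.erase a, a < j := fun j hj =>
        lt_of_le_of_ne (S.min'_le j (Finset.mem_of_mem_erase hj)) (Finset.ne_of_mem_erase hj).symm
      have hcard := Finset.card_erase_add_one haS
      rcases exists_cupOn_or_fiber hM R a (S.erase a) hlt m n (by
          rw [hR, show q + 1 + 1 = q + 2 from rfl]; omega) (by omega)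
        with ⟨i, hi, U, hUS, hUm, hcup⟩ | ⟨U, hUS, hUn, hU⟩
      · obtain ⟨T, hTU, hT⟩ := ih (R.erase i) (by rw [Finset.card_erase_of_mem hi]; omega) t
          (fun _ => rfl) U hUm.ge
        have hTi := hcup.mono hTU
        have hT' : T.card = t ∧ ∀ k ∈ R.erase i, CupOn (M k) T ∨ CapOn (M k) T := by
          rcases hT with ⟨hc, h⟩ | ⟨hc, h, -⟩
          · exact ⟨hc, fun k hk => Or.inr (h k hk)⟩
          · exact ⟨hc, h⟩
        refine ⟨T, hTU.trans (hUS.trans (Finset.erase_subset _ _)),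
          Or.inr ⟨hT'.1, fun k hk => ?_, i, hi, hTi⟩⟩
        by_cases hki : k = i
        · exact Or.inl (hki ▸ hTi)
        · exact hT'.2 k (Finset.mem_erase.2 ⟨hki, hk⟩)
      · obtain ⟨T, hTU, ⟨hc, h⟩ | h⟩ := ihs U hUn
        · have hTa : ∀ j ∈ T, a < j := fun j hj => hlt j (hUS (hTU hj))
          refine ⟨insert a T, Finset.insert_subset haS
            (hTU.trans (hUS.trans (Finset.erase_subset _ _))), Or.inl ⟨?_, fun i hi => ?_⟩⟩
          · rw [Finset.card_insert_of_notMem fun hm => (hTa _ hm).false, hc]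
          · exact (h i hi).insert_left hTa fun j hj l hl => hU i hi j (hTU hj) l (hTU hl)
        · exact ⟨T, hTU.trans (hUS.trans (Finset.erase_subset _ _)), Or.inr h⟩

/-- For all `q ≥ 1` and `s, t ≥ 2` (with `s = t` when `q = 1`), every row-increasing
`q × N` real matrix with `N ≥ 2^((q+1) s t^(q-1))` contains a cupcap submatrix that is
either `q × s` with every row a cap, or `q × t` with at least one row a cup. -/
theorem fq_bound (q s t N : ℕ) (hq : 1 ≤ q) (hs : 2 ≤ s) (ht : 2 ≤ t)
    (hqst : q = 1 → s = t) (hN : 2 ^ ((q + 1) * s * t ^ (q - 1)) ≤ N)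
    (M : Fin q → Fin N → ℝ) (hM : ∀ i, StrictMono (M i)) :
    HasCupcapSub q s t N M := by
  obtain ⟨q, rfl⟩ : ∃ p, q = p + 1 := ⟨q - 1, by omega⟩
  obtain ⟨T, -, ⟨hc, h⟩ | ⟨hc, h, i, -, hi⟩⟩ := exists_cupcapOn hM ht q Finset.univ (by simp) s
    (fun h => hqst (by omega)) Finset.univ (by simpa using hN)
  · refine Or.inl ⟨T.orderEmbOfFin hc, (T.orderEmbOfFin hc).strictMono,
      fun i => Or.inl ((hM i).comp (T.orderEmbOfFin hc).strictMono), fun i => ?_⟩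
    exact (h i (Finset.mem_univ i)).isCap hc
  · refine Or.inr ⟨T.orderEmbOfFin hc, (T.orderEmbOfFin hc).strictMono,
      fun i => Or.inl ((hM i).comp (T.orderEmbOfFin hc).strictMono), fun k => ?_, i, hi.isCup hc⟩
    exact (h k (Finset.mem_univ k)).imp (CupOn.isCup · hc) (CapOn.isCap · hc)
end

section
/- Fix integers r = 2q+2 with q ≥ 1, and reals s₁ > s₂ > ⋯ > s_q ≥ 10^6. Define t₀ = 1 and t_i = s_i t_{i−1}, and let H be the r-uniform hypergraph on [N] (with N > s₁) in which an increasing r-tuple (x₀,…,x_q,y_q,…,y₀) is an edge iff Σ_{i=0}^q (−1)^i t_i (y_i − x_i) > 0. Then the clique number of H satisfies ω(H) ≤ 10·(s_q + 2 + (log N)/(log s₁) + Σ_{i=1}^{⌊(q−1)/2⌋} (log s_{2i})/(log s_{2i+1})). -/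
/-- `NestedValue c s p k i j v` says that `v` is the alternating sum
`d₀ - s (k+1) * (d₁ - s (k+2) * (d₂ - ⋯ - s (k+p) * d_p))`, where `d₀ > d₁ > ⋯ > d_p` are the
lengths of `p + 1` strictly nested intervals with endpoints in the sequence `c`, the outermost one
running from `c i` to `c j`. -/
def NestedValue (c : ℕ → ℝ) (s : ℕ → ℝ) : ℕ → ℕ → ℕ → ℕ → ℝ → Prop
  | 0, _, i, j, v => i < j ∧ v = c j - c i
  | p + 1, k, i, j, v => ∃ i' j' v', i < i' ∧ j' < j ∧ NestedValue c s p (k + 1) i' j' v' ∧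
      v = c j - c i - s (k + 1) * v'

theorem NestedValue.lt {c s : ℕ → ℝ} {p : ℕ} : ∀ {k i j : ℕ} {v : ℝ},
    NestedValue c s p k i j v → i < j := by
  induction p with
  | zero => intro k i j v h; exact h.1
  | succ p ih =>
    rintro k i j v ⟨i', j', v', hi, hj, h, -⟩
    have := ih h
    omega

/-- A nested value is the alternating sum attached to an increasing `(2p+2)`-tuple of indices. -/
theorem NestedValue.exists_tuple {c s : ℕ → ℝ} {p : ℕ} : ∀ {k i j : ℕ} {v : ℝ},
    NestedValue c s p k i j v → ∃ a : ℕ → ℕ, a 0 = i ∧ a (2 * p + 1) = j ∧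
      (∀ m n, m < n → n < 2 * p + 2 → a m < a n) ∧
      v = ∑ l ∈ Finset.range (p + 1), (-1 : ℝ) ^ l * (∏ n ∈ Finset.range l, s (k + 1 + n)) *
        (c (a (2 * p + 1 - l)) - c (a l)) := by
  induction p with
  | zero =>
    rintro k i j v ⟨hij, rfl⟩
    refine ⟨fun n => if n = 0 then i else j, by simp, by simp, ?_, by simp⟩
    intro m n hmn hn
    obtain rfl : m = 0 := by omega
    obtain rfl : n = 1 := by omega
    simpa using hij
  | succ p ih =>
    rintro k i j v ⟨i', j', v', hi, hj, h, rfl⟩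
    obtain ⟨a, ha0, ha1, hmono, hv⟩ := ih h
    have hlt := h.lt
    have hlow : ∀ n, n < 2 * p + 2 → i' ≤ a n := by
      intro n hn
      rcases Nat.eq_zero_or_pos n with rfl | hp
      · exact ha0.ge
      · exact ha0 ▸ (hmono 0 n hp hn).le
    have hup : ∀ n, n < 2 * p + 2 → a n ≤ j' := by
      intro n hn
      rcases Nat.lt_or_ge n (2 * p + 1) with hp | hp
      · exact ha1 ▸ (hmono n _ hp (by omega)).le
      · obtain rfl : n = 2 * p + 1 := by omega
        exact ha1.le
    set b : ℕ → ℕ := fun n => if n = 0 then i else if n = 2 * p + 3 then j else a (n - 1) with hb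
    have hb0 : b 0 = i := by simp [hb]
    have hb1 : b (2 * p + 3) = j := by simp [hb]
    have hbs : ∀ n, n < 2 * p + 2 → b (n + 1) = a n := by
      intro n hn
      have : n ≠ 2 * p + 2 := by omega
      simp [hb, this]
    refine ⟨b, hb0, hb1, ?_, ?_⟩
    · intro m n hmn hn
      obtain ⟨n, rfl⟩ : ∃ n', n = n' + 1 := ⟨n - 1, by omega⟩
      rcases Nat.lt_or_ge n (2 * p + 2) with hn' | hn'
      · rw [hbs n hn']
        rcases m with _ | m
        · rw [hb0]
          exact lt_of_lt_of_le hi (hlow n hn')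
        · rw [hbs m (by omega)]
          exact hmono m n (by omega) hn'
      · obtain rfl : n = 2 * p + 2 := by omega
        rw [show 2 * p + 2 + 1 = 2 * p + 3 from rfl, hb1]
        rcases m with _ | m
        · rw [hb0]; omega
        · rw [hbs m (by omega)]
          exact lt_of_le_of_lt (hup m (by omega)) hj
    · rw [Finset.sum_range_succ', hv, Finset.mul_sum]
      have h0 : 2 * (p + 1) + 1 - 0 = 2 * p + 3 := by omega
      rw [h0, hb0, hb1, sub_eq_add_neg, add_comm, ← Finset.sum_neg_distrib]
      congr 1
      · refine Finset.sum_congr rfl fun l hl => ?_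
        have hl' : l < p + 1 := Finset.mem_range.mp hl
        have h1 : 2 * (p + 1) + 1 - (l + 1) = (2 * p + 1 - l) + 1 := by omega
        rw [h1, hbs _ (by omega), hbs _ (by omega), Finset.prod_range_succ', pow_succ]
        have h2 : ∀ n, s (k + 1 + (n + 1)) = s (k + 1 + 1 + n) := fun n => by
          congr 1; omega
        simp only [h2, add_zero]
        ring
      · simp

/-- If widening an interval of indices by one on both sides multiplies its length by at least `ρ`,
lengths grow geometrically. -/
theorem pow_mul_le_of_widening {c : ℕ → ℝ} {ρ L : ℝ} {K a b : ℕ} (hρ : 0 ≤ ρ)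
    (hbase : ∀ u, a ≤ u → u + K ≤ b → L ≤ c (u + K) - c u)
    (hstep : ∀ u n, K ≤ n → a ≤ u → u + n + 2 ≤ b →
      ρ * (c (u + 1 + n) - c (u + 1)) ≤ c (u + n + 2) - c u) :
    ∀ e u, a ≤ u → u + K + 2 * e ≤ b → ρ ^ e * L ≤ c (u + K + 2 * e) - c u := by
  intro e
  induction e with
  | zero => intro u hu hb; simpa using hbase u hu (by omega)
  | succ e ih =>
    intro u hu hb
    have h1 := ih (u + 1) (by omega) (by omega)
    have h2 := hstep u (K + 2 * e) (by omega) hu (by omega)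
    have h3 : u + 1 + (K + 2 * e) = u + 1 + K + 2 * e := by omega
    have h4 : u + (K + 2 * e) + 2 = u + K + 2 * (e + 1) := by omega
    rw [h3, h4] at h2
    calc ρ ^ (e + 1) * L = ρ * (ρ ^ e * L) := by ring
      _ ≤ ρ * (c (u + 1 + K + 2 * e) - c (u + 1)) := mul_le_mul_of_nonneg_left h1 hρ
      _ ≤ _ := h2

/-- Among `n` consecutive gaps of total length less than `D`, some gap is less than `D / n`. -/
theorem exists_small_gap {c : ℕ → ℝ} {D : ℝ} {u n : ℕ} (hn : 0 < n)
    (h : c (u + n) - c u < D) :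
    ∃ l, l < n ∧ n * (c (u + l + 1) - c (u + l)) < D := by
  by_contra! hno
  have hsum : ∑ l ∈ Finset.range n, (c (u + l + 1) - c (u + l)) = c (u + n) - c u := by
    simpa [add_assoc] using Finset.sum_range_sub (fun l => c (u + l)) n
  have hle : ∑ _l ∈ Finset.range n, D ≤
      ∑ l ∈ Finset.range n, n * (c (u + l + 1) - c (u + l)) :=
    Finset.sum_le_sum fun l hl => hno l (Finset.mem_range.mp hl)
  rw [← Finset.mul_sum, hsum, Finset.sum_const, Finset.card_range, nsmul_eq_mul] at hle
  have hn' : (0 : ℝ) < n := by exact_mod_cast hn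
  exact absurd (le_of_mul_le_mul_left hle hn') (not_le.mpr h)

theorem le_pow_ceil_log_div {x y : ℝ} (hx : 0 < x) (hy : 1 < y) :
    x ≤ y ^ ⌈Real.log x / Real.log y⌉₊ := by
  have hy0 : 0 < Real.log y := Real.log_pos hy
  rw [← Real.log_le_log_iff hx (by positivity), Real.log_pow, ← div_le_iff₀ hy0]
  exact Nat.le_ceil _

theorem log_half_ge {y : ℝ} (hy : (10 : ℝ) ^ 6 ≤ y) :
    5 / 6 * Real.log y ≤ Real.log (y / 2) ∧ 6 * Real.log 2 ≤ Real.log y := by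
  have hy0 : 0 < y := lt_of_lt_of_le (by norm_num) hy
  have h : 6 * Real.log 2 ≤ Real.log y := by
    have := Real.log_le_log (by norm_num) (show (2 : ℝ) ^ 6 ≤ y from le_trans (by norm_num) hy)
    rw [Real.log_pow] at this
    exact_mod_cast this
  refine ⟨?_, h⟩
  rw [Real.log_div hy0.ne' two_ne_zero]
  linarith

/-- Sufficiently long intervals of indices carry a nested value at least half their length. -/
theorem exists_nestedValue_ge_half {s : ℕ → ℝ} {q : ℕ}
    (hanti : ∀ i, 1 ≤ i → i < q → s (i + 1) ≤ s i)
    (hlarge : ∀ i, 1 ≤ i → i ≤ q → (10 : ℝ) ^ 6 ≤ s i) :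
    ∀ p k, 1 ≤ k → k + p = q → ∃ M : ℕ, (M : ℝ) ≤ 3 * s q +
        10 * ∑ i ∈ Finset.range (p / 2),
          Real.log (s (k + 2 * i + 1)) / Real.log (s (k + 2 * i + 2)) ∧
      ∀ c : ℕ → ℝ, StrictMono c → ∀ i j, i + M ≤ j →
        ∃ v, NestedValue c s p k i j v ∧ (c j - c i) / 2 ≤ v := by
  intro p
  induction p using Nat.twoStepInduction with
  | zero =>
    intro k hk hkq
    have hs := hlarge q (by omega) le_rfl
    refine ⟨1, by norm_num; linarith, fun c hc i j hij => ⟨_, ⟨by omega, rfl⟩, ?_⟩⟩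
    have := hc (show i < j by omega)
    linarith
  | one =>
    intro k hk hkq
    have hs := hlarge q (by omega) le_rfl
    have hceil := Nat.ceil_lt_add_one (show 0 ≤ 2 * s q by linarith)
    refine ⟨⌈2 * s q⌉₊ + 2, by push_cast; norm_num; linarith, fun c hc i j hij => ?_⟩
    obtain ⟨n, rfl⟩ : ∃ n, j = i + 1 + n + 1 := ⟨j - i - 2, by omega⟩
    have h1 := hc (show i < i + 1 by omega)
    have h2 := hc (show i + 1 + n < i + 1 + n + 1 by omega)
    obtain ⟨l, hl, hgap⟩ := exists_small_gap (n := n)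
      (by have := Nat.ceil_pos.mpr (show 0 < 2 * s q by linarith); omega)
      (show c (i + 1 + n) - c (i + 1) < c (i + 1 + n + 1) - c i by linarith)
    refine ⟨_, ⟨i + 1 + l, i + 1 + l + 1, _, by omega, by omega, ⟨by omega, rfl⟩, rfl⟩, ?_⟩
    rw [hkq]
    have h3 := hc (show i + 1 + l < i + 1 + l + 1 by omega)
    have h4 : 2 * s q ≤ n := (Nat.le_ceil _).trans (by exact_mod_cast (by omega))
    have h5 := mul_le_mul_of_nonneg_right h4 (sub_pos.mpr h3).le
    linarith
  | more p ih _ =>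
    intro k hk hkq
    obtain ⟨M, hM, hval⟩ := ih (k + 2) (by omega) (by omega)
    have hs1 := hlarge (k + 1) (by omega) (by omega)
    have hs2 := hlarge (k + 2) (by omega) (by omega)
    have hs21 : s (k + 2) ≤ s (k + 1) := hanti (k + 1) (by omega) (by omega)
    set x := s (k + 1) with hx
    set y := s (k + 2) with hy
    have hx0 : 0 < x := by linarith
    have hy0 : 0 < y := by linarith
    set e := ⌈Real.log (2 * x) / Real.log (y / 2)⌉₊ with he
    have hpow : 2 * x ≤ (y / 2) ^ e := le_pow_ceil_log_div (by linarith) (by linarith)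
    refine ⟨M + 4 + 2 * e, ?_, fun c hc i j hij => ?_⟩
    · obtain ⟨hlog1, hlog2⟩ := log_half_ge hs2
      have hlog3 : Real.log y ≤ Real.log x := Real.log_le_log hy0 hs21
      have hl2 : 0 < Real.log 2 := Real.log_pos (by norm_num)
      have hly : 0 < Real.log y := by linarith
      have hR : 1 ≤ Real.log x / Real.log y := (one_le_div hly).mpr hlog3
      have hratio : Real.log (2 * x) / Real.log (y / 2) ≤ 2 * (Real.log x / Real.log y) := by
        rw [Real.log_mul two_ne_zero hx0.ne', div_le_iff₀ (by linarith)]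
        calc Real.log 2 + Real.log x ≤ 5 / 3 * Real.log x := by linarith
          _ = 2 * (Real.log x / Real.log y) * (5 / 6 * Real.log y) := by field_simp; ring
          _ ≤ _ := mul_le_mul_of_nonneg_left hlog1 (by linarith)
      have hnn : 0 ≤ Real.log (2 * x) / Real.log (y / 2) :=
        div_nonneg (Real.log_nonneg (by linarith)) (by linarith)
      have hceil := Nat.ceil_lt_add_one hnn
      rw [← he] at hceil
      have hhalf : (p + 2) / 2 = p / 2 + 1 := by omega
      rw [hhalf, Finset.sum_range_succ']
      have hshift : ∀ n, Real.log (s (k + 2 * (n + 1) + 1)) / Real.log (s (k + 2 * (n + 1) + 2)) =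
          Real.log (s (k + 2 + 2 * n + 1)) / Real.log (s (k + 2 + 2 * n + 2)) := fun n => by
        rw [show k + 2 * (n + 1) = k + 2 + 2 * n by omega]
      simp only [hshift, mul_zero, add_zero]
      rw [← hx, ← hy]
      push_cast
      linarith
    · by_contra! hno
      set D := c j - c i with hD
      have hDpos : 0 < D := sub_pos.mpr (hc (by omega))
      have hinner : ∀ u n, M ≤ n → i + 1 ≤ u → u + n + 2 ≤ j - 1 →
          D / (2 * x) + y / 2 * (c (u + 1 + n) - c (u + 1)) ≤ c (u + n + 2) - c u := by
        intro u n hn hu hub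
        obtain ⟨v, hv, hv2⟩ := hval c hc (u + 1) (u + 1 + n) (by omega)
        have h := hno _ ⟨u, u + n + 2, _, by omega, by omega,
          ⟨u + 1, u + 1 + n, v, by omega, by omega, hv, rfl⟩, rfl⟩
        rw [← hD, ← hx, show k + 1 + 1 = k + 2 from rfl, ← hy] at h
        have h1 : D / (2 * x) < c (u + n + 2) - c u - y * v := by
          rw [div_lt_iff₀ (by linarith)]
          linarith
        have h2 := mul_le_mul_of_nonneg_left hv2 hy0.le
        linarith
      have hL : 0 < D / (2 * x) := by positivity
      have hgrow := pow_mul_le_of_widening (c := c) (ρ := y / 2) (L := D / (2 * x)) (K := M + 2)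
        (a := i + 1) (b := j - 1) (by linarith)
        (by
          intro u hu hub
          have h := hinner u M le_rfl hu (by omega)
          have h1 := hc.monotone (show u + 1 ≤ u + 1 + M by omega)
          have h2 := mul_nonneg (show 0 ≤ y / 2 by linarith) (sub_nonneg.mpr h1)
          rw [add_assoc u M 2] at h
          linarith)
        (by
          intro u n hn hu hub
          have h := hinner u n (by omega) hu hub
          linarith) e (i + 1) le_rfl (by omega)
      have h1 := hc (show i < i + 1 by omega)
      have h2 := hc (show i + 1 + (M + 2) + 2 * e < j by omega)
      have h3 : D ≤ (y / 2) ^ e * (D / (2 * x)) :=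
        calc D = 2 * x * (D / (2 * x)) := by field_simp
          _ ≤ _ := mul_le_mul_of_nonneg_right hpow hL.le
      linarith

/-- A finite set of positive integers is an initial segment of a strictly increasing sequence. -/
theorem exists_strictMono_enumeration {N : ℕ} {C : Finset ℕ} (hC : C ⊆ Finset.Icc 1 N) :
    ∃ f : ℕ → ℕ, StrictMono f ∧ ∀ n < C.card, f n ∈ C := by
  classical
  have hinf : {n | n ∈ C ∨ N < n}.Infinite :=
    (Set.Ioi_infinite N).mono fun n hn => Or.inr hn
  refine ⟨Nat.nth fun n => n ∈ C ∨ N < n, Nat.nth_strictMono hinf, fun n hn => ?_⟩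
  have hcount : Nat.count (fun n => n ∈ C ∨ N < n) (N + 1) = C.card := by
    rw [Nat.count_eq_card_filter_range]
    congr 1
    ext m
    simp only [Finset.mem_filter, Finset.mem_range]
    constructor
    · rintro ⟨h1, h | h⟩
      · exact h
      · omega
    · intro h
      have := Finset.mem_Icc.mp (hC h)
      exact ⟨by omega, Or.inl h⟩
  have hlt := Nat.nth_lt_of_lt_count (hcount.symm ▸ hn)
  rcases Nat.nth_mem_of_infinite hinf n with h | h
  · exact h
  · omega


open Finset in
/-- Let `r = 2q+2` with `q ≥ 1` and `s 1 > ⋯ > s q ≥ 10^6`. With `t i = s 1 ⋯ s i`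
(`t 0 = 1`), let `H` be the `r`-uniform hypergraph on `[N]` (`N > s 1`) in which an
increasing `r`-tuple `(x₀,…,x_q,y_q,…,y₀)` is an edge iff
`Σ_{i=0}^q (-1)^i t i (y i - x i) > 0`. Then
`ω(H) ≤ 10 (s q + 2 + log N / log (s 1) + Σ_{i=1}^{⌊(q-1)/2⌋} log (s (2i)) / log (s (2i+1)))`. -/
theorem cliqueNumber_bound (q N : ℕ) (hq : 1 ≤ q) (s : ℕ → ℝ)
    (hs : ∀ i j, 1 ≤ i → i < j → j ≤ q → s j < s i) (hsq : (10 : ℝ) ^ 6 ≤ s q)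
    (hN : s 1 < N)
    (C : Finset ℕ) (hC : C ⊆ Finset.Icc 1 N)
    (hclique : ∀ a : ℕ → ℕ,
      (∀ i j, i < j → j < 2 * q + 2 → a i < a j) →
      (∀ i, i < 2 * q + 2 → a i ∈ C) →
      0 < ∑ i ∈ Finset.range (q + 1),
        (-1 : ℝ) ^ i * (∏ j ∈ Finset.Icc 1 i, s j) *
          ((a (2 * q + 1 - i) : ℝ) - (a i : ℝ))) :
    (C.card : ℝ) ≤ 10 * (s q + 2 + Real.log N / Real.log (s 1) +
      ∑ i ∈ Finset.Icc 1 ((q - 1) / 2), Real.log (s (2 * i)) / Real.log (s (2 * i + 1))) := by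
  have hanti : ∀ i, 1 ≤ i → i < q → s (i + 1) ≤ s i := fun i h1 h2 =>
    (hs i (i + 1) h1 (by omega) h2).le
  have hlarge : ∀ i, 1 ≤ i → i ≤ q → (10 : ℝ) ^ 6 ≤ s i := by
    intro i h1 h2
    rcases h2.lt_or_eq with h | rfl
    · exact hsq.trans (hs i q h1 h le_rfl).le
    · exact hsq
  obtain ⟨p, rfl⟩ : ∃ p, q = p + 1 := ⟨q - 1, by omega⟩
  obtain ⟨M, hM, hval⟩ := exists_nestedValue_ge_half hanti hlarge p 1 le_rfl (by omega)
  obtain ⟨f, hf, hfC⟩ := exists_strictMono_enumeration hC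
  have hs1 := hlarge 1 le_rfl (by omega)
  have hs0 : 0 < s 1 := by linarith
  have hNpos : (0 : ℝ) < N := by linarith
  have hc : StrictMono fun n => (f n : ℝ) := fun a b h => Nat.cast_lt.mpr (hf h)
  have hpos : ∀ i j v, j < C.card →
      NestedValue (fun n => (f n : ℝ)) s (p + 1) 0 i j v → 0 < v := by
    intro i j v hj hv
    obtain ⟨a, -, ha1, hmono, rfl⟩ := hv.exists_tuple
    have hmem : ∀ n, n < 2 * (p + 1) + 2 → f (a n) ∈ C := by
      intro n hn
      apply hfC
      rcases Nat.lt_or_ge n (2 * (p + 1) + 1) with h | h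
      · have := hmono n _ h (by omega)
        omega
      · obtain rfl : n = 2 * (p + 1) + 1 := by omega
        omega
    have h := hclique (fun n => f (a n)) (fun m n hmn hn => hf (hmono m n hmn hn)) hmem
    have hprod : ∀ l, ∏ n ∈ Finset.range l, s (0 + 1 + n) = ∏ n ∈ Finset.Icc 1 l, s n := by
      intro l
      rw [← Finset.Ico_add_one_right_eq_Icc, Finset.prod_Ico_eq_prod_range]
      simp
    simpa only [hprod] using h
  have hsum : ∑ i ∈ Finset.range (p / 2),
      Real.log (s (1 + 2 * i + 1)) / Real.log (s (1 + 2 * i + 2)) =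
      ∑ i ∈ Finset.Icc 1 ((p + 1 - 1) / 2),
        Real.log (s (2 * i)) / Real.log (s (2 * i + 1)) := by
    rw [← Finset.Ico_add_one_right_eq_Icc, Finset.sum_Ico_eq_sum_range]
    refine Finset.sum_congr (by simp) fun i _ => ?_
    rw [show 2 * (1 + i) = 1 + 2 * i + 1 by omega]
  rw [hsum] at hM
  obtain ⟨hlog1, hlog2⟩ := log_half_ge hs1
  have hl2 : 0 < Real.log 2 := Real.log_pos (by norm_num)
  have hlN : 0 ≤ Real.log N := Real.log_nonneg (by linarith)
  have hratio : Real.log N / Real.log (s 1 / 2) ≤ 2 * (Real.log N / Real.log (s 1)) := by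
    rw [← mul_div_assoc, div_le_div_iff₀ (by linarith) (by linarith)]
    have := mul_le_mul_of_nonneg_left
      (show Real.log (s 1) ≤ 2 * Real.log (s 1 / 2) by linarith) hlN
    linarith
  have hceil := Nat.ceil_lt_add_one (show 0 ≤ Real.log N / Real.log (s 1 / 2) from
    div_nonneg hlN (by linarith))
  have hpow := le_pow_ceil_log_div hNpos (show 1 < s 1 / 2 by linarith)
  set e := ⌈Real.log N / Real.log (s 1 / 2)⌉₊ with he
  have hcard : C.card ≤ M + 1 + 2 * e := by
    by_contra! hlt
    have hgrow := pow_mul_le_of_widening (c := fun n => (f n : ℝ)) (ρ := s 1 / 2) (L := 1)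
      (K := M + 1) (a := 0) (b := C.card - 1) (by linarith)
      (by
        intro u _ _
        have h : f u + 1 ≤ f (u + (M + 1)) := hf (by omega)
        have h' : (f u : ℝ) + 1 ≤ f (u + (M + 1)) := by exact_mod_cast h
        linarith)
      (by
        intro u n hn _ hub
        obtain ⟨v, hv, hv2⟩ := hval _ hc (u + 1) (u + 1 + n) (by omega)
        have h := hpos u (u + n + 2) _ (by omega)
          ⟨u + 1, u + 1 + n, v, by omega, by omega, hv, rfl⟩
        have h2 := mul_le_mul_of_nonneg_left hv2 hs0.le
        simp only [zero_add] at h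
        linarith) e 0 le_rfl (by omega)
    have h1 := Finset.mem_Icc.mp (hC (hfC 0 (by omega)))
    have h2 := Finset.mem_Icc.mp (hC (hfC (0 + (M + 1) + 2 * e) (by omega)))
    have h1' : (1 : ℝ) ≤ f 0 := by exact_mod_cast h1.1
    have h2' : (f (0 + (M + 1) + 2 * e) : ℝ) ≤ N := by exact_mod_cast h2.2
    linarith
  have hcard' : (C.card : ℝ) ≤ M + 1 + 2 * e := by exact_mod_cast hcard
  have hq0 : 0 ≤ Real.log N / Real.log (s 1) := div_nonneg hlN (by linarith)
  linarith
end

section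
/- For every even integer r ≥ 4 there is a constant c > 0 such that for all sufficiently large n there exists an r-uniform hypergraph H on at least 2^{c n^{r/2 − 1}} vertices, semi-linear of complexity (1,1) (edges determined by the sign of a single linear function of the vertex coordinates in ℝ), with both clique number and independence number less than n. -/
open Finset

/-- Every gap `b - a` of `S` is within a factor `3/4 .. 5/4` of `ε ^ ν a b`, with `ν a b < B`. -/
def IsLacunary (ε : ℝ) (B : ℕ) (ν : ℝ → ℝ → ℕ) (S : Finset ℝ) : Prop :=
  ∀ a ∈ S, ∀ b ∈ S, a < b → ν a b < B ∧ 3 / 4 * ε ^ ν a b ≤ b - a ∧ b - a ≤ 5 / 4 * ε ^ ν a b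

/-- The exponent of `ε` in the weight of the `i`-th gap. -/
def gapExponent (K p i : ℕ) : ℕ := if i ≤ K then p ^ (K - i) else p ^ (i - (K + 2))

/-- The sign of the weight of the `i`-th gap. -/
def gapSign (K i : ℕ) : ℝ := if i ≤ K then (-1) ^ i else -(-1) ^ i

/-- The weight of the `i`-th gap; the middle gap is ignored. -/
noncomputable def gapWeight (K p : ℕ) (ε : ℝ) (i : ℕ) : ℝ :=
  if i = K + 1 then 0 else gapSign K i * ε ^ gapExponent K p i

/-- The linear form on `(2 * K + 4)`-tuples given by the weighted sum of consecutive gaps. -/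
noncomputable def gapForm (K p : ℕ) (ε : ℝ) (q : ℕ → ℝ) : ℝ :=
  ∑ i ∈ range (2 * K + 3), gapWeight K p ε i * (q (i + 1) - q i)

/-- The first `2 * K + 4` values of `q` form an increasing tuple in `C`. -/
def IsIncreasingTuple (K : ℕ) (C : Finset ℝ) (q : ℕ → ℝ) : Prop :=
  (∀ i < 2 * K + 4, q i ∈ C) ∧ ∀ i < 2 * K + 3, q i < q (i + 1)

/-- The form takes both strict signs on increasing tuples of `C`. -/
def HasBothSigns (K p : ℕ) (ε : ℝ) (C : Finset ℝ) : Prop :=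
  (∃ q, IsIncreasingTuple K C q ∧ 0 < gapForm K p ε q) ∧
    ∃ q, IsIncreasingTuple K C q ∧ gapForm K p ε q < 0

lemma HasBothSigns.mono {K p : ℕ} {ε : ℝ} {C D : Finset ℝ} (h : HasBothSigns K p ε C)
    (hCD : C ⊆ D) : HasBothSigns K p ε D := by
  obtain ⟨⟨q, hq, hq'⟩, u, hu, hu'⟩ := h
  exact ⟨⟨q, ⟨fun i hi => hCD (hq.1 i hi), hq.2⟩, hq'⟩, u, ⟨fun i hi => hCD (hu.1 i hi), hu.2⟩, hu'⟩

lemma gapSign_mul_self (K i : ℕ) : gapSign K i * gapSign K i = 1 := by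
  unfold gapSign
  split_ifs <;> simp [← mul_pow]

lemma abs_gapSign (K i : ℕ) : |gapSign K i| = 1 := by
  unfold gapSign
  split_ifs <;> simp

lemma HasBothSigns.of_opposite {K p : ℕ} {ε : ℝ} {C : Finset ℝ} {s s' : ℕ}
    (hs : gapSign K s' = -gapSign K s)
    (h : ∃ q, IsIncreasingTuple K C q ∧ 0 < gapSign K s * gapForm K p ε q)
    (h' : ∃ q, IsIncreasingTuple K C q ∧ 0 < gapSign K s' * gapForm K p ε q) :
    HasBothSigns K p ε C := by
  obtain ⟨q, hq, hq'⟩ := h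
  obtain ⟨u, hu, hu'⟩ := h'
  rw [hs] at hu'
  have h1 := gapSign_mul_self K s
  rcases mul_self_eq_one_iff.1 h1 with e | e <;> rw [e] at hq' hu'
  · exact ⟨⟨q, hq, by linarith⟩, u, hu, by linarith⟩
  · exact ⟨⟨u, hu, by linarith⟩, q, hq, by linarith⟩

lemma le_of_pow_le_five_mul {ε : ℝ} (h0 : 0 < ε) (h1 : ε ≤ 1 / 6) {a b : ℕ}
    (h : ε ^ a ≤ 5 * ε ^ b) : b ≤ a := by
  by_contra! hab
  have h2 : ε ^ b ≤ ε ^ (a + 1) := pow_le_pow_of_le_one h0.le (by linarith) hab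
  have h3 : 0 < ε ^ a := pow_pos h0 a
  rw [pow_succ] at h2
  nlinarith

lemma sum_pos_of_dominant {n s : ℕ} (hs : s < n) {u : ℕ → ℝ} {x ε : ℝ} (hx : 0 < x)
    (hε : ε * n ≤ 1 / 2) (h0 : 0 < ε) (hu : 3 / 4 * x ≤ u s)
    (h : ∀ j < n, j ≠ s → |u j| ≤ 5 / 4 * (x * ε)) : 0 < ∑ i ∈ range n, u i := by
  rw [← Finset.add_sum_erase _ _ (mem_range.2 hs)]
  have h1 : |∑ i ∈ (range n).erase s, u i| ≤ ∑ i ∈ (range n).erase s, 5 / 4 * (x * ε) :=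
    (abs_sum_le_sum_abs _ _).trans <| Finset.sum_le_sum fun i hi => by
      rw [mem_erase, mem_range] at hi
      exact h i hi.2 hi.1
  rw [Finset.sum_const, card_erase_of_mem (mem_range.2 hs), card_range, nsmul_eq_mul] at h1
  have h2 : ((n - 1 : ℕ) : ℝ) ≤ n := by exact_mod_cast Nat.sub_le _ _
  have h3 : ((n - 1 : ℕ) : ℝ) * (5 / 4 * (x * ε)) ≤ n * (5 / 4 * (x * ε)) := by gcongr
  have h4 := neg_abs_le (∑ i ∈ (range n).erase s, u i)
  nlinarith

section Lacunary

variable {K p B : ℕ} {ε : ℝ} {ν : ℝ → ℝ → ℕ} {S : Finset ℝ}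

lemma IsLacunary.mono (h : IsLacunary ε B ν S) {C : Finset ℝ} (hC : C ⊆ S) :
    IsLacunary ε B ν C :=
  fun a ha b hb => h a (hC ha) b (hC hb)

lemma IsLacunary.ultrametric (h : IsLacunary ε B ν S) (h0 : 0 < ε) (h1 : ε ≤ 1 / 6)
    {a b c : ℝ} (ha : a ∈ S) (hb : b ∈ S) (hc : c ∈ S) (hab : a < b) (hbc : b < c) :
    ν a b ≠ ν b c ∧ ν a c = min (ν a b) (ν b c) := by
  obtain ⟨-, u1, u2⟩ := h a ha b hb hab
  obtain ⟨-, v1, v2⟩ := h b hb c hc hbc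
  obtain ⟨-, w1, w2⟩ := h a ha c hc (hab.trans hbc)
  have pu := pow_pos h0 (ν a b)
  have pv := pow_pos h0 (ν b c)
  have pw := pow_pos h0 (ν a c)
  have e1 : ν a c ≤ ν a b := le_of_pow_le_five_mul h0 h1 (by linarith)
  have e2 : ν a c ≤ ν b c := le_of_pow_le_five_mul h0 h1 (by linarith)
  have e3 : ν a c = min (ν a b) (ν b c) := by
    apply le_antisymm (le_min e1 e2)
    rcases le_total (ν a b) (ν b c) with hh | hh
    · have := pow_le_pow_of_le_one h0.le (by linarith : ε ≤ 1) hh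
      rw [min_eq_left hh]
      exact le_of_pow_le_five_mul h0 h1 (by linarith)
    · have := pow_le_pow_of_le_one h0.le (by linarith : ε ≤ 1) hh
      rw [min_eq_right hh]
      exact le_of_pow_le_five_mul h0 h1 (by linarith)
  refine ⟨fun e => ?_, e3⟩
  rw [e, min_self] at e3
  rw [e] at u1
  rw [e3] at w2
  linarith

lemma IsLacunary.gapForm_pos (h : IsLacunary ε B ν S) (h0 : 0 < ε)
    (hε : ε * (2 * K + 3 : ℕ) ≤ 1 / 2) {q : ℕ → ℝ} (hq : IsIncreasingTuple K S q) {s : ℕ}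
    (hs : s < 2 * K + 3) (hsK : s ≠ K + 1)
    (hdom : ∀ j < 2 * K + 3, j ≠ s → j ≠ K + 1 →
      ν (q s) (q (s + 1)) + gapExponent K p s < ν (q j) (q (j + 1)) + gapExponent K p j) :
    0 < gapSign K s * gapForm K p ε q := by
  unfold gapForm
  rw [Finset.mul_sum]
  have hε1 : ε ≤ 1 := by
    push_cast at hε
    nlinarith [(Nat.cast_nonneg K : (0 : ℝ) ≤ K)]
  have gap : ∀ j < 2 * K + 3, 3 / 4 * ε ^ ν (q j) (q (j + 1)) ≤ q (j + 1) - q j ∧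
      q (j + 1) - q j ≤ 5 / 4 * ε ^ ν (q j) (q (j + 1)) := fun j hj =>
    (h _ (hq.1 j (by omega)) _ (hq.1 (j + 1) (by omega)) (hq.2 j hj)).2
  refine sum_pos_of_dominant hs
    (pow_pos h0 (ν (q s) (q (s + 1)) + gapExponent K p s)) hε h0 ?_ ?_
  · rw [gapWeight, if_neg hsK, ← mul_assoc, ← mul_assoc, gapSign_mul_self, one_mul, pow_add]
    have := pow_pos h0 (gapExponent K p s)
    nlinarith [(gap s hs).1]
  · intro j hj hjs
    by_cases hjK : j = K + 1
    · rw [gapWeight, if_pos hjK]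
      simp only [zero_mul, mul_zero, abs_zero]
      positivity
    · rw [gapWeight, if_neg hjK, abs_mul, abs_mul, abs_mul, abs_gapSign, abs_gapSign, one_mul,
        one_mul, abs_of_pos (pow_pos h0 _), abs_of_pos (sub_pos.2 (hq.2 j hj)), ← pow_succ]
      have e1 := pow_le_pow_of_le_one h0.le hε1 (hdom j hj hjs hjK)
      rw [pow_add _ _ (gapExponent K p j)] at e1
      have := pow_pos h0 (gapExponent K p j)
      rw [Nat.succ_eq_add_one] at e1
      nlinarith [(gap j hj).2]

lemma IsLacunary.exists_cut (h : IsLacunary ε B ν S) (h0 : 0 < ε) (h1 : ε ≤ 1 / 6)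
    (hS : 2 ≤ S.card) :
    ∃ L ⊆ S, ∃ R ⊆ S, L.Nonempty ∧ R.Nonempty ∧ S.card = L.card + R.card ∧ ∃ d,
      (∀ l ∈ L, ∀ r ∈ R, l < r ∧ ν l r = d) ∧ (∀ l ∈ L, ∀ l' ∈ L, l < l' → d < ν l l') ∧
      ∀ r ∈ R, ∀ r' ∈ R, r < r' → d < ν r r' := by
  classical
  have hne : S.Nonempty := Finset.card_pos.1 (by omega)
  obtain ⟨a, ha, hamin⟩ : ∃ a ∈ S, ∀ x ∈ S, a ≤ x :=
    ⟨S.min' hne, S.min'_mem hne, fun x hx => S.min'_le x hx⟩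
  obtain ⟨z, hz, hzmax⟩ : ∃ z ∈ S, ∀ x ∈ S, x ≤ z :=
    ⟨S.max' hne, S.max'_mem hne, fun x hx => S.le_max' x hx⟩
  have haz : a ≠ z := by
    rintro rfl
    obtain ⟨x, hx, hxa⟩ := Finset.exists_mem_ne (by omega : 1 < S.card) a
    exact hxa (le_antisymm (hzmax x hx) (hamin x hx))
  have ult := fun {x y w : ℝ} => h.ultrametric h0 h1 (a := x) (b := y) (c := w)
  have hR : ∀ r ∈ S, ¬(r = a ∨ ν a z < ν a r) → a < r ∧ ν a r = ν a z := by
    intro r hr hr'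
    push Not at hr'
    have har := lt_of_le_of_ne (hamin r hr) (Ne.symm hr'.1)
    refine ⟨har, ?_⟩
    rcases eq_or_lt_of_le (hzmax r hr) with e | e
    · rw [e]
    · have := (ult ha hr hz har e).2
      omega
  refine ⟨S.filter fun x => x = a ∨ ν a z < ν a x, filter_subset _ _,
    S.filter fun x => ¬(x = a ∨ ν a z < ν a x), filter_subset _ _,
    ⟨a, by simp [ha]⟩, ⟨z, by simp [hz, haz.symm]⟩,
    (card_filter_add_card_filter_not _).symm, ν a z, ?_, ?_, ?_⟩
  · intro l hl r hr
    rw [mem_filter] at hl hr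
    obtain ⟨har, hν⟩ := hR r hr.1 hr.2
    rcases hl.2 with rfl | hl'
    · exact ⟨har, hν⟩
    · rcases eq_or_lt_of_le (hamin l hl.1) with e | hal
      · rw [← e]
        exact ⟨har, hν⟩
      rcases lt_trichotomy l r with e | e | e
      · have := (ult ha hl.1 hr.1 hal e).2
        exact ⟨e, by omega⟩
      · subst e; omega
      · have := (ult ha hr.1 hl.1 har e).2
        omega
  · intro l hl l' hl' hll
    rw [mem_filter] at hl hl'
    have hal' : a < l' := lt_of_le_of_lt (hamin l hl.1) hll
    have h2 : ν a z < ν a l' := hl'.2.resolve_left hal'.ne'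
    rcases eq_or_lt_of_le (hamin l hl.1) with e | e
    · rwa [← e]
    · have := (ult ha hl.1 hl'.1 e hll).2
      omega
  · intro r hr r' hr' hrr
    rw [mem_filter] at hr hr'
    obtain ⟨h2, h3⟩ := hR r hr.1 hr.2
    obtain ⟨h4, h5⟩ := hR r' hr'.1 hr'.2
    have := ult ha hr.1 hr'.1 h2 hrr
    omega

lemma exists_increasing_enumeration (A : Finset ℝ) :
    ∃ a : ℕ → ℝ, (∀ i < A.card, a i ∈ A) ∧ ∀ i j, i < j → j < A.card → a i < a j := by
  refine ⟨fun t => if ht : t < A.card then A.orderEmbOfFin rfl ⟨t, ht⟩ else 0, ?_, ?_⟩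
  · intro i hi
    simp only [hi, dif_pos]
    exact A.orderEmbOfFin_mem rfl _
  · intro i j hij hj
    simp only [hij.trans hj, hj, dif_pos]
    exact (A.orderEmbOfFin rfl).strictMono hij

lemma gapSign_mid (K : ℕ) : gapSign K (K + 2) = -gapSign K K := by
  simp [gapSign, pow_add]

lemma one_le_gapExponent (hp : 0 < p) (i : ℕ) : 1 ≤ gapExponent K p i := by
  unfold gapExponent
  split_ifs <;> exact Nat.one_le_pow _ _ hp

lemma IsLacunary.exists_gapForm_pos_of_cut (h : IsLacunary ε B ν S) (h0 : 0 < ε)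
    (hε : ε * (2 * K + 3 : ℕ) ≤ 1 / 2) (hp : 0 < p) {L R : Finset ℝ} (hL : L ⊆ S) (hR : R ⊆ S)
    (hLc : 2 * K + 4 ≤ L.card) (hRc : 2 * K + 4 ≤ R.card) {d : ℕ}
    (hLR : ∀ l ∈ L, ∀ r ∈ R, l < r ∧ ν l r = d) (hLL : ∀ l ∈ L, ∀ l' ∈ L, l < l' → d < ν l l')
    (hRR : ∀ r ∈ R, ∀ r' ∈ R, r < r' → d < ν r r') {s : ℕ} (hs : s < 2 * K + 3)
    (hsK : s ≠ K + 1) (hs1 : gapExponent K p s = 1) :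
    ∃ q, IsIncreasingTuple K S q ∧ 0 < gapSign K s * gapForm K p ε q := by
  obtain ⟨l, hl, hl'⟩ := exists_increasing_enumeration L
  obtain ⟨r, hr, hr'⟩ := exists_increasing_enumeration R
  have hq : IsIncreasingTuple K S fun i => if i ≤ s then l i else r i := by
    constructor
    · intro i hi
      dsimp only
      split_ifs
      · exact hL (hl i (by omega))
      · exact hR (hr i (by omega))
    · intro i hi
      dsimp only
      split_ifs
      · exact hl' _ _ (by omega) (by omega)
      · exact (hLR _ (hl i (by omega)) _ (hr _ (by omega))).1
      · omega
      · exact hr' _ _ (by omega) (by omega)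
  refine ⟨_, hq, h.gapForm_pos h0 hε hq hs hsK fun j hj hjs hjK => ?_⟩
  have e1 := one_le_gapExponent (K := K) hp j
  have e2 := (hLR _ (hl s (by omega)) _ (hr (s + 1) (by omega))).2
  rw [hs1, if_pos le_rfl, if_neg (by omega), e2]
  rcases lt_or_gt_of_ne hjs with e | e
  · rw [if_pos e.le, if_pos (Nat.succ_le_of_lt e)]
    have := hLL _ (hl j (by omega)) _ (hl (j + 1) (by omega)) (hl' _ _ (by omega) (by omega))
    omega
  · rw [if_neg (by omega), if_neg (by omega)]
    have := hRR _ (hr j (by omega)) _ (hr (j + 1) (by omega)) (hr' _ _ (by omega) (by omega))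
    omega

lemma IsLacunary.exists_monotone_subsets (h : IsLacunary ε B ν S) (h0 : 0 < ε) (h1 : ε ≤ 1 / 6)
    (hε : ε * (2 * K + 3 : ℕ) ≤ 1 / 2) (hp : 0 < p) (hS : ¬HasBothSigns K p ε S) :
    ∃ A ⊆ S, ∃ A' ⊆ S,
      (∀ a ∈ A, ∀ b ∈ A, ∀ c ∈ A, a < b → b < c → ν a b < ν b c) ∧
      (∀ a ∈ A', ∀ b ∈ A', ∀ c ∈ A', a < b → b < c → ν b c < ν a b) ∧
      S.card ≤ (2 * K + 4) * (A.card + A'.card) := by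
  classical
  induction S using Finset.strongInduction with
  | H S ih =>
  rcases lt_or_ge S.card 2 with hc | hc
  · have hsub : ∀ a ∈ S, ∀ b ∈ S, ¬a < b := fun a ha b hb hab =>
      hab.ne (Finset.card_le_one.1 (by omega) a ha b hb)
    exact ⟨S, Subset.rfl, S, Subset.rfl, fun a ha b hb _ _ hab => (hsub a ha b hb hab).elim,
      fun a ha b hb _ _ hab => (hsub a ha b hb hab).elim, by nlinarith⟩
  obtain ⟨L, hL, R, hR, ⟨l₀, hl₀⟩, ⟨r₀, hr₀⟩, hcard, d, hLR, hLL, hRR⟩ := h.exists_cut h0 h1 hc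
  have hLss : L ⊂ S := Finset.ssubset_iff_subset_ne.2 ⟨hL, fun e =>
    (lt_irrefl _ (hLR r₀ (e ▸ hR hr₀) r₀ hr₀).1)⟩
  have hRss : R ⊂ S := Finset.ssubset_iff_subset_ne.2 ⟨hR, fun e =>
    (lt_irrefl _ (hLR l₀ hl₀ l₀ (e ▸ hL hl₀)).1)⟩
  by_cases hLc : L.card < 2 * K + 4
  · obtain ⟨A, hA, A', hA', h2, h3, h4⟩ := ih R hRss (h.mono hR) fun hb => hS (hb.mono hR)
    have hlA : ∀ x ∈ A, l₀ < x ∧ ν l₀ x = d := fun x hx => hLR _ hl₀ _ (hA hx)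
    have hn : l₀ ∉ A := fun hl => lt_irrefl _ (hlA _ hl).1
    refine ⟨insert l₀ A, insert_subset (hL hl₀) (hA.trans hR), A', hA'.trans hR, ?_, h3, ?_⟩
    · intro a ha b hb c hc hab hbc
      rw [mem_insert] at ha hb hc
      rcases hb with rfl | hb
      · rcases ha with rfl | ha
        · exact (lt_irrefl _ hab).elim
        · exact (lt_asymm hab (hlA a ha).1).elim
      rcases hc with rfl | hc
      · exact (lt_asymm hbc (hlA b hb).1).elim
      rcases ha with rfl | ha
      · rw [(hlA b hb).2]
        exact hRR _ (hA hb) _ (hA hc) hbc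
      · exact h2 a ha b hb c hc hab hbc
    · rw [card_insert_of_notMem hn]
      nlinarith
  by_cases hRc : R.card < 2 * K + 4
  · obtain ⟨A, hA, A', hA', h2, h3, h4⟩ := ih L hLss (h.mono hL) fun hb => hS (hb.mono hL)
    have hlA : ∀ x ∈ A', x < r₀ ∧ ν x r₀ = d := fun x hx => hLR _ (hA' hx) _ hr₀
    have hn : r₀ ∉ A' := fun hl => lt_irrefl _ (hlA _ hl).1
    refine ⟨A, hA.trans hL, insert r₀ A', insert_subset (hR hr₀) (hA'.trans hL), h2, ?_, ?_⟩
    · intro a ha b hb c hc hab hbc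
      rw [mem_insert] at ha hb hc
      rcases hb with rfl | hb
      · rcases hc with rfl | hc
        · exact (lt_irrefl _ hbc).elim
        · exact (lt_asymm hbc (hlA c hc).1).elim
      rcases ha with rfl | ha
      · exact (lt_asymm hab (hlA b hb).1).elim
      rcases hc with rfl | hc
      · rw [(hlA b hb).2]
        exact hLL _ (hA' ha) _ (hA' hb) hab
      · exact h3 a ha b hb c hc hab hbc
    · rw [card_insert_of_notMem hn]
      nlinarith
  refine (hS (HasBothSigns.of_opposite (gapSign_mid K) ?_ ?_)).elim
  · exact h.exists_gapForm_pos_of_cut h0 hε hp hL hR (by omega) (by omega) hLR hLL hRR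
      (by omega) (by omega) (by simp [gapExponent])
  · exact h.exists_gapForm_pos_of_cut h0 hε hp hL hR (by omega) (by omega) hLR hLL hRR
      (by omega) (by omega) (by simp [gapExponent])

/-- An arithmetic dichotomy: a strictly increasing sequence of length `m` below `p ^ (K + 1)`
has, at some scale, a short stretch followed by two long jumps. -/
lemma exists_stretch_and_jumps {N : ℕ → ℕ} {m : ℕ} (hp : 2 ≤ p)
    (hN : ∀ i j, i < j → j < m → N i < N j) (hB : ∀ i < m, N i < p ^ (K + 1))
    (hm : 4 * p * (K + 1) * (K + 1) < m) :
    ∃ i < K, ∃ t, t + (2 * p * (K + 1) + 4 * (K + 1)) * (i + 1) < m ∧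
      N (t + (K + 1)) < N t + p ^ i * (p - 1) ∧
      ∀ u, t ≤ u → u ≤ t + K →
        N u + p ^ i ≤ N (u + 2 * (K + 1)) ∧ N u + p ^ (i + 1) ≤ N (u + 2 * p * (K + 1)) := by
  by_contra! hno
  set Q := 2 * p * (K + 1) + 4 * (K + 1) with hQ
  have key : ∀ i ≤ K, ∀ t, t + Q * i + 2 * p * (K + 1) < m →
      N t + p ^ i ≤ N (t + 2 * (K + 1)) ∧ N t + p ^ (i + 1) ≤ N (t + 2 * p * (K + 1)) := by
    intro i
    induction i with
    | zero =>
      intro _ t ht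
      have step : ∀ j, t + j < m → N t + j ≤ N (t + j) := by
        intro j
        induction j with
        | zero => simp
        | succ j ihj =>
          intro hj
          have := ihj (by omega)
          have := hN (t + j) (t + (j + 1)) (by omega) hj
          omega
      have e1 : 2 * (K + 1) ≤ 2 * p * (K + 1) := by nlinarith
      have e2 : p ≤ 2 * p * (K + 1) := by nlinarith
      have h1 := step (2 * (K + 1)) (by omega)
      have h2 := step (2 * p * (K + 1)) (by omega)
      simp only [pow_zero, zero_add, pow_one]
      omega
    | succ i ih =>
      intro hi t ht
      have ih := ih (by omega)
      have hexp : Q * (i + 1) = Q * i + Q := by ring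
      have long : ∀ u, u + Q * (i + 1) < m → N u + p ^ i * (p - 1) ≤ N (u + (K + 1)) := by
        intro u hu
        by_contra! hlt
        obtain ⟨v, hv, hv', hv''⟩ := hno i (by omega) u hu hlt
        have := ih v (by omega)
        have := hv'' this.1
        omega
      have steps : ∀ l ≤ 2 * p, N t + l * (p ^ i * (p - 1)) ≤ N (t + l * (K + 1)) := by
        intro l
        induction l with
        | zero => simp
        | succ l ihl =>
          intro hl
          have h1 := ihl (by omega)
          have h2 : l * (K + 1) ≤ 2 * p * (K + 1) := Nat.mul_le_mul_right _ (by omega)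
          have h3 := long (t + l * (K + 1)) (by omega)
          have h4 : t + (l + 1) * (K + 1) = t + l * (K + 1) + (K + 1) := by ring
          rw [h4, Nat.succ_mul]
          omega
      have hpp : p ≤ 2 * (p - 1) := by omega
      have e1 : p ^ (i + 1) ≤ 2 * (p ^ i * (p - 1)) := by
        rw [pow_succ]
        calc p ^ i * p ≤ p ^ i * (2 * (p - 1)) := Nat.mul_le_mul_left _ hpp
          _ = _ := by ring
      have e2 : p ^ (i + 1 + 1) ≤ 2 * p * (p ^ i * (p - 1)) := by
        rw [pow_succ]
        calc p ^ (i + 1) * p ≤ 2 * (p ^ i * (p - 1)) * p := Nat.mul_le_mul_right _ e1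
          _ = _ := by ring
      have h1 := steps 2 (by omega)
      have h2 := steps (2 * p) le_rfl
      omega
  have hlen : Q * K + 2 * p * (K + 1) < m := by
    have : Q ≤ 4 * p * (K + 1) := by nlinarith
    nlinarith
  have h1 := (key K le_rfl 0 (by omega)).2
  have h2 := hB (0 + 2 * p * (K + 1)) (by omega)
  omega

lemma IsLacunary.hasBothSigns_of_comb (h : IsLacunary ε (p ^ (K + 1)) ν S) (h0 : 0 < ε)
    (h1 : ε ≤ 1 / 6) (hε : ε * (2 * K + 3 : ℕ) ≤ 1 / 2) (hp : 2 ≤ p)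
    (hcomb : ∀ a ∈ S, ∀ b ∈ S, ∀ c ∈ S, a < b → b < c → ν a b < ν b c)
    (hcard : 6 * p * (K + 1) * (K + 1) ≤ S.card) : HasBothSigns K p ε S := by
  obtain ⟨a, haS, ha⟩ := exists_increasing_enumeration S
  obtain ⟨m, hm⟩ : ∃ m, S.card = m + 1 := ⟨S.card - 1, by
    have : 0 < 6 * p * (K + 1) * (K + 1) := by positivity
    omega⟩
  rw [hm] at haS ha
  have hν : ∀ i j, i < j → j < m + 1 → ν (a i) (a j) = ν (a i) (a (i + 1)) := by
    intro i j hij hj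
    rcases Nat.eq_or_lt_of_le (Nat.succ_le_of_lt hij) with e | e
    · rw [← e]
    · have hi1 := haS i (by omega)
      have hi2 := haS (i + 1) (by omega)
      have hi3 := haS j hj
      have hl1 := ha i (i + 1) (by omega) (by omega)
      have hl2 := ha (i + 1) j e hj
      have := (h.ultrametric h0 h1 hi1 hi2 hi3 hl1 hl2).2
      have := hcomb _ hi1 _ hi2 _ hi3 hl1 hl2
      omega
  have hN : ∀ i j, i < j → j < m → ν (a i) (a (i + 1)) < ν (a j) (a (j + 1)) := by
    intro i j hij hj
    rw [← hν i j hij (by omega)]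
    exact hcomb _ (haS i (by omega)) _ (haS j (by omega)) _ (haS (j + 1) (by omega))
      (ha _ _ hij (by omega)) (ha _ _ (by omega) (by omega))
  have hB : ∀ i < m, ν (a i) (a (i + 1)) < p ^ (K + 1) := fun i hi =>
    (h _ (haS i (by omega)) _ (haS (i + 1) (by omega)) (ha _ _ (by omega) (by omega))).1
  have dom : ∀ s ≤ K, ∀ t T, t + T + (2 * K + 3) < m + 1 →
      (s = 0 ∨ ν (a (t + s)) (a (t + s + 1)) <
        ν (a t) (a (t + 1)) + p ^ (K - s) * (p - 1)) →
      ν (a (t + s)) (a (t + s + 1)) + p ^ (K - s) ≤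
        ν (a (t + s + 1 + T)) (a (t + s + 1 + T + 1)) →
      ∃ q, IsIncreasingTuple K S q ∧ 0 < gapSign K s * gapForm K p ε q := by
    intro s hs t T hT hw hj
    have hq : IsIncreasingTuple K S fun i => a (if i ≤ s then t + i else t + T + i) := by
      constructor
      · intro i hi
        exact haS _ (by split_ifs <;> omega)
      · intro i hi
        exact ha _ _ (by split_ifs <;> omega) (by split_ifs <;> omega)
    refine ⟨_, hq, h.gapForm_pos h0 hε hq (by omega) (by omega) fun j hj1 hjs hjK => ?_⟩
    have hνs : ∀ i < 2 * K + 3, ν (a (if i ≤ s then t + i else t + T + i))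
        (a (if i + 1 ≤ s then t + (i + 1) else t + T + (i + 1))) =
        ν (a (if i ≤ s then t + i else t + T + i))
          (a ((if i ≤ s then t + i else t + T + i) + 1)) := fun i hi =>
      hν _ _ (by split_ifs <;> omega) (by split_ifs <;> omega)
    rw [hνs j hj1, hνs s (by omega), if_pos le_rfl]
    have hes : gapExponent K p s = p ^ (K - s) := if_pos hs
    rw [hes]
    rcases lt_or_gt_of_ne hjs with e | e
    · rw [if_pos e.le]
      have hej : gapExponent K p j = p ^ (K - j) := if_pos (by omega)
      have e1 : p ^ (K - s) * p ≤ p ^ (K - j) := by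
        rw [← pow_succ]
        exact Nat.pow_le_pow_right (by omega) (by omega)
      have e2 : p ^ (K - s) * p = p ^ (K - s) * (p - 1) + p ^ (K - s) := by
        rw [← Nat.mul_succ]
        congr 1
        omega
      have e3 : ν (a t) (a (t + 1)) ≤ ν (a (t + j)) (a (t + j + 1)) := by
        rcases Nat.eq_zero_or_pos j with rfl | hj0
        · rfl
        · exact (hN _ _ (by omega) (by omega)).le
      have e4 := hw.resolve_left (by omega)
      rw [hej]
      omega
    · rw [if_neg (by omega)]
      have e1 := one_le_gapExponent (K := K) (p := p) (by omega) j
      have e2 : ν (a (t + s + 1 + T)) (a (t + s + 1 + T + 1)) ≤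
          ν (a (t + T + j)) (a (t + T + j + 1)) := by
        rcases Nat.eq_or_lt_of_le (Nat.succ_le_of_lt e) with e3 | e3
        · rw [← e3, show t + T + s.succ = t + s + 1 + T by omega]
        · exact (hN _ _ (by omega) (by omega)).le
      omega
  have hm' : 4 * p * (K + 1) * (K + 1) < m := by
    have : 2 ≤ p * (K + 1) * (K + 1) := by nlinarith [Nat.zero_le (p * K * K), Nat.zero_le (p * K)]
    have e1 : 4 * p * (K + 1) * (K + 1) = 4 * (p * (K + 1) * (K + 1)) := by ring
    have e2 : 6 * p * (K + 1) * (K + 1) = 6 * (p * (K + 1) * (K + 1)) := by ring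
    omega
  obtain ⟨i, hi, t, ht, hw, hj⟩ := exists_stretch_and_jumps (K := K) hp hN hB hm'
  have hlen : t + (2 * p * (K + 1) + 4 * (K + 1)) < m := by
    have : 2 * p * (K + 1) + 4 * (K + 1) ≤ (2 * p * (K + 1) + 4 * (K + 1)) * (i + 1) :=
      Nat.le_mul_of_pos_right _ (by omega)
    omega
  have hpK : 2 * (K + 1) ≤ 2 * p * (K + 1) := by nlinarith
  have hwin : ∀ s ≤ K, ν (a (t + s)) (a (t + s + 1)) <
      ν (a t) (a (t + 1)) + p ^ i * (p - 1) := fun s hs =>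
    (hN (t + s) (t + (K + 1)) (by omega) (by omega)).trans hw
  have hsign : gapSign K (K - i) = -gapSign K (K - i - 1) := by
    rw [gapSign, gapSign, if_pos (by omega), if_pos (by omega)]
    obtain ⟨e, he⟩ : ∃ e, K - i = e + 1 := ⟨K - i - 1, by omega⟩
    rw [he, pow_succ]
    simp
  have hi1 : K - (K - i) = i := by omega
  have hi2 : K - (K - i - 1) = i + 1 := by omega
  refine HasBothSigns.of_opposite hsign
    (dom (K - i - 1) (by omega) t (2 * p * (K + 1)) (by omega) (Or.inr ?_) ?_)
    (dom (K - i) (by omega) t (2 * (K + 1)) (by omega) (Or.inr ?_) ?_)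
  · rw [hi2]
    refine (hwin _ (by omega)).trans_le (Nat.add_le_add_left (Nat.mul_le_mul_right _ ?_) _)
    exact Nat.pow_le_pow_right (by omega) (by omega)
  · rw [hi2]
    exact (hj (t + (K - i - 1)) (by omega) (by omega)).2.trans
      (hN _ _ (by omega) (by omega)).le
  · rw [hi1]
    exact hwin _ (by omega)
  · rw [hi1]
    exact (hj (t + (K - i)) (by omega) (by omega)).1.trans
      (hN _ _ (by omega) (by omega)).le

lemma exists_isLacunary (h0 : 0 < ε) (h1 : ε ≤ 1 / 6) (B : ℕ) :
    ∃ S : Finset ℝ, S.card = 2 ^ B ∧ ∃ ν, IsLacunary ε B ν S := by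
  suffices H : ∃ S : Finset ℝ, S.card = 2 ^ B ∧ (∀ a ∈ S, 0 ≤ a ∧ a ≤ 5 / 4) ∧
      ∀ a ∈ S, ∀ b ∈ S, a < b → ∃ n < B, 3 / 4 * ε ^ n ≤ b - a ∧ b - a ≤ 5 / 4 * ε ^ n by
    obtain ⟨S, hS, -, h⟩ := H
    choose! ν hν using h
    exact ⟨S, hS, ν, hν⟩
  induction B with
  | zero => exact ⟨{0}, by simp, by norm_num, by simp⟩
  | succ B ih =>
    classical
    obtain ⟨S, hS, hb, h⟩ := ih
    have hmul : ∀ a ∈ S, 0 ≤ ε * a ∧ ε * a ≤ 5 / 24 := fun a ha => by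
      obtain ⟨ha1, ha2⟩ := hb a ha
      constructor
      · positivity
      · nlinarith
    have scale : ∀ a ∈ S, ∀ b ∈ S, ε * a < ε * b → ∃ n < B + 1,
        3 / 4 * ε ^ n ≤ ε * b - ε * a ∧ ε * b - ε * a ≤ 5 / 4 * ε ^ n := by
      intro a ha b hb' hab
      obtain ⟨n, hn, h2, h3⟩ := h a ha b hb' (lt_of_mul_lt_mul_left hab h0.le)
      exact ⟨n + 1, by omega, by rw [pow_succ]; nlinarith, by rw [pow_succ]; nlinarith⟩
    refine ⟨S.image (fun a => ε * a) ∪ S.image (fun a => 1 + ε * a), ?_, ?_, ?_⟩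
    · rw [card_union_of_disjoint, card_image_of_injective, card_image_of_injective, hS, pow_succ]
      · ring
      · intro a b hab
        simpa [h0.ne'] using hab
      · intro a b hab
        simpa [h0.ne'] using hab
      · rw [disjoint_left]
        intro x hx hx'
        obtain ⟨a, ha, rfl⟩ := mem_image.1 hx
        obtain ⟨b, hb', e⟩ := mem_image.1 hx'
        linarith [hmul a ha, hmul b hb']
    · intro x hx
      rcases mem_union.1 hx with hx | hx <;> obtain ⟨a, ha, rfl⟩ := mem_image.1 hx <;>
        have := hmul a ha <;> constructor <;> linarith
    · intro x hx y hy hxy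
      rcases mem_union.1 hx with hx | hx <;> obtain ⟨a, ha, rfl⟩ := mem_image.1 hx <;>
        rcases mem_union.1 hy with hy | hy <;> obtain ⟨b, hb', rfl⟩ := mem_image.1 hy <;>
        have ha' := hmul a ha <;> have hb'' := hmul b hb'
      · exact scale a ha b hb' hxy
      · exact ⟨0, by omega, by rw [pow_zero]; linarith, by rw [pow_zero]; linarith⟩
      · linarith
      · obtain ⟨n, hn, h2, h3⟩ := scale a ha b hb' (by linarith)
        exact ⟨n, hn, by linarith, by linarith⟩

lemma gapWeight_reflect {i : ℕ} (hi : i < 2 * K + 3) :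
    gapWeight K p ε (2 * K + 3 - 1 - i) = -gapWeight K p ε i := by
  unfold gapWeight gapSign gapExponent
  rcases lt_trichotomy i (K + 1) with h | h | h
  · obtain ⟨e, he⟩ : ∃ e, K = i + e := ⟨K - i, by omega⟩
    rw [if_neg (show 2 * K + 3 - 1 - i ≠ K + 1 by omega),
      if_neg (show ¬2 * K + 3 - 1 - i ≤ K by omega),
      if_neg (show ¬2 * K + 3 - 1 - i ≤ K by omega), if_neg h.ne,
      if_pos (show i ≤ K by omega), if_pos (show i ≤ K by omega), show 2 * K + 3 - 1 - i - (K + 2) = K - i by omega,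
      show 2 * K + 3 - 1 - i = i + 2 * (e + 1) by omega, pow_add, pow_mul]
    simp
  · rw [if_pos (by omega), if_pos h, neg_zero]
  · rw [if_neg (show 2 * K + 3 - 1 - i ≠ K + 1 by omega),
      if_pos (show 2 * K + 3 - 1 - i ≤ K by omega),
      if_pos (show 2 * K + 3 - 1 - i ≤ K by omega), if_neg h.ne',
      if_neg (show ¬i ≤ K by omega), if_neg (show ¬i ≤ K by omega), show K - (2 * K + 3 - 1 - i) = i - (K + 2) by omega]
    obtain ⟨e, he⟩ : ∃ e, i = 2 * K + 3 - 1 - i + 2 * e := ⟨i - (K + 1), by omega⟩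
    have : ((-1 : ℝ)) ^ i = (-1) ^ (2 * K + 3 - 1 - i) := by
      conv_lhs => rw [he, pow_add, pow_mul]
      simp
    rw [this]
    ring

lemma gapForm_reflect (q : ℕ → ℝ) :
    gapForm K p ε (fun i => -q (2 * K + 3 - i)) = -gapForm K p ε q := by
  unfold gapForm
  rw [← Finset.sum_range_reflect, ← Finset.sum_neg_distrib]
  refine Finset.sum_congr rfl fun i hi => ?_
  rw [mem_range] at hi
  dsimp only
  rw [gapWeight_reflect hi, show 2 * K + 3 - (2 * K + 3 - 1 - i + 1) = i by omega,
    show 2 * K + 3 - (2 * K + 3 - 1 - i) = i + 1 by omega]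
  ring

lemma IsIncreasingTuple.reflect {q : ℕ → ℝ} {C D : Finset ℝ} (hq : IsIncreasingTuple K C q)
    (hD : ∀ x ∈ C, -x ∈ D) : IsIncreasingTuple K D fun i => -q (2 * K + 3 - i) := by
  refine ⟨fun i hi => hD _ (hq.1 _ (by omega)), fun i hi => ?_⟩
  have := hq.2 (2 * K + 3 - (i + 1)) (by omega)
  rw [show 2 * K + 3 - (i + 1) + 1 = 2 * K + 3 - i by omega] at this
  exact neg_lt_neg this

lemma HasBothSigns.reflect {C D : Finset ℝ} (h : HasBothSigns K p ε C)
    (hD : ∀ x ∈ C, -x ∈ D) : HasBothSigns K p ε D := by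
  obtain ⟨⟨q, hq, hq'⟩, u, hu, hu'⟩ := h
  exact ⟨⟨_, hu.reflect hD, by rw [gapForm_reflect]; linarith⟩,
    ⟨_, hq.reflect hD, by rw [gapForm_reflect]; linarith⟩⟩

lemma IsLacunary.hasBothSigns (h : IsLacunary ε (p ^ (K + 1)) ν S) (h0 : 0 < ε)
    (h1 : ε ≤ 1 / 6) (hε : ε * (2 * K + 3 : ℕ) ≤ 1 / 2) (hp : 2 ≤ p)
    (hcard : 24 * (K + 2) * (K + 1) * (K + 1) * p ≤ S.card) : HasBothSigns K p ε S := by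
  classical
  by_contra hS
  obtain ⟨A, hA, A', hA', hcomb, hcomb', hc⟩ :=
    h.exists_monotone_subsets h0 h1 hε (by omega : 0 < p) hS
  have hlarge : 6 * p * (K + 1) * (K + 1) ≤ A.card ∨ 6 * p * (K + 1) * (K + 1) ≤ A'.card := by
    by_contra! hlt
    have : (2 * K + 4) * (A.card + A'.card) <
        (2 * K + 4) * (6 * p * (K + 1) * (K + 1) + 6 * p * (K + 1) * (K + 1)) :=
      Nat.mul_lt_mul_of_pos_left (by omega) (by omega)
    nlinarith
  rcases hlarge with hl | hl
  · exact hS (((h.mono hA).hasBothSigns_of_comb h0 h1 hε hp hcomb hl).mono hA)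
  · have hmem : ∀ x ∈ A'.image (fun x => -x), -x ∈ A' := by simp
    have hlac : IsLacunary ε (p ^ (K + 1)) (fun a b => ν (-b) (-a)) (A'.image fun x => -x) := by
      intro a ha b hb hab
      have := h _ (hA' (hmem b hb)) _ (hA' (hmem a ha)) (neg_lt_neg hab)
      rwa [show -a - -b = b - a by ring] at this
    refine hS (((hlac.hasBothSigns_of_comb h0 h1 hε hp ?_ ?_).reflect hmem).mono hA')
    · intro a ha b hb c hc hab hbc
      exact hcomb' _ (hmem c hc) _ (hmem b hb) _ (hmem a ha) (neg_lt_neg hbc) (neg_lt_neg hab)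
    · rwa [card_image_of_injective _ neg_injective]

end Lacunary

lemma exists_weights_gapForm (K p : ℕ) (ε : ℝ) : ∃ w : Fin (2 * K + 4) → ℝ, ∀ q : ℕ → ℝ,
    gapForm K p ε q = ∑ i, w i * q i := by
  let f : (Fin (2 * K + 4) → ℝ) →ₗ[ℝ] ℝ :=
    ∑ i : Fin (2 * K + 3), gapWeight K p ε i •
      (LinearMap.proj (R := ℝ) (φ := fun _ : Fin (2 * K + 4) => ℝ) i.succ -
        LinearMap.proj (R := ℝ) (φ := fun _ : Fin (2 * K + 4) => ℝ) i.castSucc)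
  refine ⟨fun i => f (Pi.single i 1), fun q => ?_⟩
  have h1 : gapForm K p ε q = f fun i => q i := by
    simp [f, gapForm, Finset.sum_range]
  rw [h1, LinearMap.pi_apply_eq_sum_univ f]
  refine Finset.sum_congr rfl fun i _ => ?_
  rw [smul_eq_mul, mul_comm]
  congr 2
  ext j
  simp [Pi.single_apply, eq_comm]

lemma IsIncreasingTuple.exists_lift {K N : ℕ} {x : Fin N → ℝ} (hx : StrictMono x)
    {C : Finset (Fin N)} {q : ℕ → ℝ} (hq : IsIncreasingTuple K (C.image x) q) :
    ∃ u : Fin (2 * K + 4) → Fin N, StrictMono u ∧ (∀ i, u i ∈ C) ∧ ∀ i, x (u i) = q i := by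
  have h : ∀ i : Fin (2 * K + 4), ∃ c ∈ C, x c = q i := fun i => mem_image.1 (hq.1 i i.2)
  choose u hu hu' using h
  refine ⟨u, ?_, hu, hu'⟩
  refine Fin.strictMono_iff_lt_succ (n := 2 * K + 3).2 fun i => hx.lt_iff_lt.1 ?_
  rw [hu', hu']
  exact hq.2 i i.2

/-- For every even `r ≥ 4` there is `c > 0` such that for all sufficiently large `n`
there is an `r`-uniform hypergraph `H` on `N ≥ 2^(c n^(r/2 - 1))` vertices, semi-linear
of complexity `(1,1)` (vertices are reals `x₁ < ⋯ < x_N` and whether an increasing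
`r`-tuple is an edge is determined by the sign of a single linear function `f`), with
`ω(H) < n` and `α(H) < n`. -/
theorem semilinear_ramsey_lower (r : ℕ) (hr : 4 ≤ r) (hreven : Even r) :
    ∃ c : ℝ, 0 < c ∧ ∃ n₀ : ℕ, ∀ n : ℕ, n₀ ≤ n →
      ∃ N : ℕ, (2 : ℝ) ^ (c * (n : ℝ) ^ (r / 2 - 1 : ℕ)) ≤ (N : ℝ) ∧
        ∃ x : Fin N → ℝ, StrictMono x ∧
          ∃ (w : Fin r → ℝ) (b : ℝ) (Φ : SignType → Prop),
            (∀ C : Finset (Fin N),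
              (∀ q : Fin r → Fin N, StrictMono q → (∀ i, q i ∈ C) →
                Φ (SignType.sign (b + ∑ i, w i * x (q i)))) →
              C.card < n) ∧
            (∀ C : Finset (Fin N),
              (∀ q : Fin r → Fin N, StrictMono q → (∀ i, q i ∈ C) →
                ¬ Φ (SignType.sign (b + ∑ i, w i * x (q i)))) →
              C.card < n) := by
  obtain ⟨K, rfl⟩ : ∃ K, r = 2 * K + 4 := by
    obtain ⟨k, hk⟩ := hreven
    exact ⟨k - 2, by omega⟩
  obtain ⟨D, hD⟩ : ∃ D, D = 24 * (K + 2) * (K + 1) * (K + 1) := ⟨_, rfl⟩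
  have hD0 : 0 < D := by rw [hD]; positivity
  refine ⟨(1 / (2 * D)) ^ (K + 1), by positivity, 2 * D, fun n hn => ?_⟩
  rw [show (2 * K + 4) / 2 - 1 = K + 1 by omega]
  have hp : 2 ≤ n / D := (Nat.le_div_iff_mul_le hD0).2 hn
  have hpn : D * (n / D) ≤ n := Nat.mul_div_le n D
  have hnp : (n : ℝ) ≤ 2 * D * (n / D : ℕ) := by
    have h1 := Nat.lt_mul_div_succ n hD0
    have h2 : D ≤ D * (n / D) := Nat.le_mul_of_pos_right _ (by omega)
    have h3 : n ≤ 2 * D * (n / D) := by nlinarith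
    exact_mod_cast h3
  generalize n / D = p at hp hpn hnp
  obtain ⟨ε, hεdef⟩ : ∃ ε : ℝ, ε = 1 / (2 * (2 * K + 3)) := ⟨_, rfl⟩
  have hK : (0 : ℝ) ≤ K := Nat.cast_nonneg K
  have h0 : 0 < ε := by rw [hεdef]; positivity
  have hε : ε * (2 * K + 3 : ℕ) ≤ 1 / 2 := by
    rw [hεdef]
    push_cast
    apply le_of_eq
    field_simp
  have h1 : ε ≤ 1 / 6 := by
    push_cast at hε
    nlinarith
  obtain ⟨S, hS, ν, hν⟩ := exists_isLacunary h0 h1 (p ^ (K + 1))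
  obtain ⟨w, hw⟩ := exists_weights_gapForm K p ε
  have hx : StrictMono (S.orderEmbOfFin hS) := (S.orderEmbOfFin hS).strictMono
  have both : ∀ C : Finset (Fin (2 ^ p ^ (K + 1))), n ≤ C.card →
      HasBothSigns K p ε (C.image (S.orderEmbOfFin hS)) := by
    intro C hC
    have hsub : C.image (S.orderEmbOfFin hS) ⊆ S := by
      intro y hy
      obtain ⟨c, -, rfl⟩ := mem_image.1 hy
      exact S.orderEmbOfFin_mem hS c
    refine (hν.mono hsub).hasBothSigns h0 h1 hε hp ?_
    rw [card_image_of_injective _ hx.injective, ← hD]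
    exact hpn.trans hC
  have hform : ∀ (q : ℕ → ℝ) (u : Fin (2 * K + 4) → Fin (2 ^ p ^ (K + 1))),
      (∀ i, S.orderEmbOfFin hS (u i) = q i) →
      0 + ∑ i, w i * S.orderEmbOfFin hS (u i) = gapForm K p ε q := by
    intro q u hu
    rw [zero_add, hw]
    exact Finset.sum_congr rfl fun i _ => by rw [hu]
  refine ⟨2 ^ p ^ (K + 1), ?_, S.orderEmbOfFin hS, hx, w, 0, fun s => s = 1, ?_, ?_⟩
  · have hle : (1 / (2 * D) : ℝ) ^ (K + 1) * (n : ℝ) ^ (K + 1) ≤ ((p ^ (K + 1) : ℕ) : ℝ) := by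
      rw [← mul_pow]
      push_cast
      refine pow_le_pow_left₀ (by positivity) ?_ _
      rw [one_div, inv_mul_le_iff₀ (by positivity)]
      exact hnp
    calc (2 : ℝ) ^ ((1 / (2 * D) : ℝ) ^ (K + 1) * (n : ℝ) ^ (K + 1))
        ≤ (2 : ℝ) ^ ((p ^ (K + 1) : ℕ) : ℝ) := Real.rpow_le_rpow_of_exponent_le (by norm_num) hle
      _ = ((2 ^ p ^ (K + 1) : ℕ) : ℝ) := by rw [Real.rpow_natCast]; push_cast; rfl
  · intro C hC
    by_contra! hn'
    obtain ⟨-, q, hq, hq'⟩ := both C hn'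
    obtain ⟨u, hu, huC, hux⟩ := hq.exists_lift hx
    have := hC u hu huC
    rw [hform q u hux, sign_eq_one_iff] at this
    linarith
  · intro C hC
    by_contra! hn'
    obtain ⟨⟨q, hq, hq'⟩, -⟩ := both C hn'
    obtain ⟨u, hu, huC, hux⟩ := hq.exists_lift hx
    refine hC u hu huC ?_
    rw [hform q u hux]
    exact sign_pos hq'
end
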